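/- arXiv:math/9806022 — 2 statements merged into one kernel-verified Lean document; each statement's English description precedes it below -/
import Mathlib

section
/- Let X be a separable Banach space, let (ℱ_n)_{n≥0} be a filtration with ℱ_0 trivial, and let (f_n) and (g_n) be X-valued sequences adapted to (ℱ_n) that are tangent, where (f_n) is additionally a Bochner integrable martingale difference sequence with respect to (ℱ_n). Then the functions h_n : [0,1]^n → X and φ_n : [0,1]^n → [0,1] representing ((f_n),(g_n)) as tangent sequences may be chosen so that, in addition, ∫_0^1 h_n(x_1,…,x_{n−1},x_n) dx_n = 0 for almost every (x_1,…,x_{n−1}). -/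
open MeasureTheory MeasurableSpace
open scoped unitInterval

noncomputable section

/-- The product Lebesgue measure on `[0,1]^n`. -/
def lamFin (n : ℕ) : Measure (Fin n → I) := Measure.pi fun _ => volume

/-- The canonical lifting of a sequence of functions `g k : [0,1]^(k+1) → S`
(0-based indexing) to a map `[0,1]^n → S^n` recording the first `n` terms. -/
def seqLift {S : Type*} (g : (k : ℕ) → (Fin (k + 1) → I) → S) (n : ℕ) :
    (Fin n → I) → Fin n → S :=
  fun x k => g k (fun j => x ⟨j.1, lt_of_lt_of_le j.2 k.2⟩)

section Coupling

open ProbabilityTheory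

lemma map_prodMk_eq_compProd {A S : Type*} [MeasurableSpace A] [MeasurableSpace S]
    (μ : Measure A) [SFinite μ] (r : Kernel A S) [IsSFiniteKernel r] {Φ : A → I → S}
    (hΦ : Measurable (Function.uncurry Φ)) (hr : ∀ᵐ a ∂μ, volume.map (Φ a) = r a) :
    (μ.prod volume).map (fun z : A × I => (z.1, Φ z.1 z.2)) = μ ⊗ₘ r := by
  ext s hs
  have hm : Measurable fun z : A × I => (z.1, Φ z.1 z.2) := measurable_fst.prodMk hΦ
  rw [Measure.map_apply hm hs, Measure.prod_apply (hm hs), Measure.compProd_apply hs]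
  refine lintegral_congr_ae ?_
  filter_upwards [hr] with a ha
  have hΦa : Measurable (Φ a) := hΦ.comp measurable_prodMk_left
  rw [← ha, Measure.map_apply hΦa (measurable_prodMk_left hs)]
  rfl

lemma measurePreserving_and_map_eq_of_disintegration {S : Type*} [MeasurableSpace S]
    [StandardBorelSpace S] (ν : Measure (S × S)) [IsProbabilityMeasure ν]
    (c : Kernel S S) [IsMarkovKernel c] (d : Kernel S I) [IsMarkovKernel d]
    {h : I → S} {φ : I → I} (hm : Measurable h) (hφm : Measurable φ)
    (hc : ν.fst ⊗ₘ c = ν)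
    (hd : ν.fst ⊗ₘ d = volume.map fun t => (h t, t))
    (hs : ν.fst = ν.snd)
    (hφ : volume.map (fun t => (h t, φ t)) = ν.fst ⊗ₘ (d ∘ₖ c)) :
    MeasurePreserving φ ∧ volume.map (fun t => (h t, h (φ t))) = ν := by
  have hsnd : c ∘ₘ ν.fst = ν.fst := by
    conv_rhs => rw [hs, ← hc, Measure.snd_compProd]
  have hfst : volume.map h = ν.fst := by
    have := congrArg Measure.fst hd
    rw [Measure.fst_compProd, Measure.fst_map_prodMk measurable_id'] at this
    exact this.symm
  have hdirac : ⇑(d.map h) =ᵐ[ν.fst] ⇑(Kernel.id : Kernel S S) := by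
    refine Kernel.ae_eq_of_compProd_eq ?_
    rw [Measure.compProd_map hm, hd, Measure.compProd_id, ← hfst, Measure.map_map (by fun_prop)
      (by fun_prop), Measure.map_map (by fun_prop) hm]
    rfl
  refine ⟨⟨hφm, ?_⟩, ?_⟩
  · have h1 := congrArg Measure.snd hφ
    rw [Measure.snd_map_prodMk hm, Measure.snd_compProd, ← Measure.comp_assoc, hsnd,
      ← Measure.snd_compProd, hd, Measure.snd_map_prodMk hm] at h1
    simpa using h1
  · have h1 : volume.map (fun t => (h t, h (φ t)))
        = (volume.map (fun t => (h t, φ t))).map (Prod.map id h) := by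
      rw [Measure.map_map (by fun_prop) (by fun_prop)]; rfl
    rw [h1, hφ, ← Measure.compProd_map hm, Kernel.map_comp]
    conv_rhs => rw [← hc]
    refine Measure.compProd_congr ?_
    rw [← hsnd] at hdirac
    filter_upwards [Measure.ae_ae_of_ae_comp hdirac] with a ha
    rw [Kernel.comp_apply, Measure.bind_congr_right ha, ← Kernel.comp_apply, Kernel.id_comp]

/-- A Markov kernel into `S × S` can be represented by measurable maps `H` and `Φ` in such a way
that, whenever the two marginals at `p` agree, `Φ p` preserves Lebesgue measure and the law at `p`
is that of `(H p, H p ∘ Φ p)`. -/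
lemma exists_measurable_coupling {P S : Type*} [MeasurableSpace P] [MeasurableSpace S]
    [StandardBorelSpace S] [Nonempty S] (κ : Kernel P (S × S)) [IsMarkovKernel κ] :
    ∃ (H : P → I → S) (Φ : P → I → I), Measurable (Function.uncurry H) ∧
      Measurable (Function.uncurry Φ) ∧ ∀ p, (κ p).fst = (κ p).snd →
        MeasurePreserving (Φ p) ∧ volume.map (fun t => (H p t, H p (Φ p t))) = κ p := by
  obtain ⟨H₀, hH₀, hH₀κ⟩ := Kernel.exists_measurable_map_eq_unitInterval κ.fst
  obtain ⟨e, he, hev⟩ :=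
    Measure.exists_measurable_map_eq ((volume : Measure I).prod (volume : Measure I))
  have hκfst (p) : κ.fst p = (κ p).fst := Kernel.fst_apply κ p
  have hH₀p (p) : Measurable (H₀ p) := hH₀.comp measurable_prodMk_left
  let H : P → I → S := fun p t => H₀ p (e t).1
  have hH : Measurable (Function.uncurry H) :=
    hH₀.comp (measurable_fst.prodMk (measurable_fst.comp (he.comp measurable_snd)))
  have hHp (p) : Measurable (H p) := hH.comp measurable_prodMk_left
  have hHκ (p) : volume.map (H p) = (κ p).fst := by
    have : volume.map (fun t => (e t).1) = (volume : Measure I) := by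
      have := congrArg (Measure.map Prod.fst) hev
      rwa [Measure.map_map measurable_fst he, Measure.map_fst_prod, measure_univ, one_smul] at this
    rw [← hκfst, ← hH₀κ p]
    conv_rhs => rw [← this]
    rw [Measure.map_map (hH₀p p) (by fun_prop)]
    rfl
  have hHt : Measurable fun z : P × I => (H z.1 z.2, z.2) := hH.prodMk measurable_snd
  let lam : Kernel P (S × I) :=
    ((Kernel.id : Kernel P P) ×ₖ Kernel.const P (volume : Measure I)).map
      fun z => (H z.1 z.2, z.2)
  have hlam (p) : lam p = volume.map fun t => (H p t, t) := by
    rw [Kernel.map_apply _ hHt, Kernel.prod_apply, Kernel.id_apply, Kernel.const_apply,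
      Measure.dirac_prod, Measure.map_map hHt measurable_prodMk_left]
    rfl
  have : IsMarkovKernel lam := Kernel.IsMarkovKernel.map _ hHt
  let c (p) : Kernel S S := κ.condKernel.sectR p
  let d (p) : Kernel S I := lam.condKernel.sectR p
  let r : Kernel (P × S) I := (κ.condKernel ⊗ₖ
    lam.condKernel.comap (fun x : (P × S) × S => (x.1.1, x.2)) (by fun_prop)).snd
  have hr (p a) : r (p, a) = (d p ∘ₖ c p) a := by
    rw [Kernel.snd_apply, Kernel.compProd_apply_eq_compProd_sectR]
    exact Measure.snd_compProd _ _
  obtain ⟨R, hR, hRr⟩ := Kernel.exists_measurable_map_eq_unitInterval r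
  have hΦ : Measurable (Function.uncurry fun p t => R (p, H p t) (e t).2) :=
    hR.comp ((measurable_fst.prodMk hH).prodMk (measurable_snd.comp (he.comp measurable_snd)))
  refine ⟨H, fun p t => R (p, H p t) (e t).2, hH, hΦ, fun p hp => ?_⟩
  have hRp : Measurable (Function.uncurry fun a v => R (p, a) v) :=
    hR.comp ((measurable_const.prodMk measurable_fst).prodMk measurable_snd)
  refine measurePreserving_and_map_eq_of_disintegration (κ p) (c p) (d p) (hHp p)
    (hΦ.comp measurable_prodMk_left) ?_ ?_ hp ?_
  · rw [← hκfst, ← Kernel.compProd_apply_eq_compProd_sectR, Kernel.disintegrate]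
  · have hfst : (κ p).fst = lam.fst p := by
      rw [Kernel.fst_apply, hlam, ← hHκ]
      exact (Measure.fst_map_prodMk measurable_id').symm
    rw [hfst, ← Kernel.compProd_apply_eq_compProd_sectR, Kernel.disintegrate, hlam]
  · rw [← map_prodMk_eq_compProd (κ p).fst (d p ∘ₖ c p) hRp
      (.of_forall fun a => by rw [hRr, hr])]
    have h1 : ((κ p).fst).prod volume = volume.map (fun t => (H p t, (e t).2)) := by
      rw [← hκfst, ← hH₀κ p]
      conv_lhs => arg 2; rw [← Measure.map_id (μ := (volume : Measure I))]
      rw [Measure.map_prod_map _ _ (hH₀p p) measurable_id, ← hev, Measure.map_map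
        (by fun_prop) he]
      rfl
    have hm : Measurable fun z : S × I => (z.1, R (p, z.1) z.2) := measurable_fst.prodMk hRp
    have hm' : Measurable fun t => (H p t, (e t).2) := (hHp p).prodMk (by fun_prop)
    rw [h1, Measure.map_map hm hm']
    rfl

/-- If `F` and `G` have the same joint law with `Z`, the conditional law of `(F, G)` given `Z` is
represented by a function together with a measure preserving rearrangement of it. -/
lemma exists_coupling_of_map_eq {Ω P S : Type*} [MeasurableSpace Ω] [MeasurableSpace P]
    [MeasurableSpace S] [StandardBorelSpace S] [Nonempty S] (μ : Measure Ω)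
    [IsProbabilityMeasure μ] {Z : Ω → P} {F G : Ω → S} (hF : Measurable F)
    (hG : Measurable G)
    (hlaw : μ.map (fun ω => (Z ω, F ω)) = μ.map (fun ω => (Z ω, G ω))) :
    ∃ (H : P → I → S) (Φ : P → I → I), Measurable (Function.uncurry H) ∧
      Measurable (Function.uncurry Φ) ∧
      (∀ᵐ p ∂(μ.map Z), MeasurePreserving (Φ p)) ∧
      (∀ᵐ p ∂(μ.map Z), volume.map (H p) = condDistrib F Z μ p) ∧
      ((μ.map Z).prod volume).map (fun z => (z.1, (H z.1 z.2, H z.1 (Φ z.1 z.2))))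
        = μ.map (fun ω => (Z ω, (F ω, G ω))) := by
  have hFG : Measurable fun ω => (F ω, G ω) := hF.prodMk hG
  let κ := condDistrib (fun ω => (F ω, G ω)) Z μ
  obtain ⟨H, Φ, hH, hΦ, hκ⟩ := exists_measurable_coupling κ
  have h1 : condDistrib F Z μ =ᵐ[μ.map Z] κ.map Prod.fst :=
    condDistrib_comp Z hFG.aemeasurable measurable_fst
  have h2 : condDistrib G Z μ =ᵐ[μ.map Z] κ.map Prod.snd :=
    condDistrib_comp Z hFG.aemeasurable measurable_snd
  have h3 : condDistrib F Z μ =ᵐ[μ.map Z] condDistrib G Z μ :=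
    condDistrib_ae_eq_of_measure_eq_compProd Z hF.aemeasurable
      (by rw [compProd_map_condDistrib hG.aemeasurable, hlaw])
  have h4 : ∀ᵐ p ∂(μ.map Z), (κ p).fst = (κ p).snd := by
    filter_upwards [h1, h2, h3] with p e1 e2 e3
    rw [e1, e2, Kernel.map_apply _ measurable_fst, Kernel.map_apply _ measurable_snd] at e3
    exact e3
  have hHΦ : Measurable (Function.uncurry fun p t => (H p t, H p (Φ p t))) :=
    hH.prodMk (hH.comp (measurable_fst.prodMk hΦ))
  refine ⟨H, Φ, hH, hΦ, ?_, ?_, ?_⟩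
  · filter_upwards [h4] with p hp using (hκ p hp).1
  · filter_upwards [h4, h1] with p hp e1
    have h5 := congrArg Measure.fst (hκ p hp).2
    have hΦp : Measurable (fun t => H p (Φ p t)) :=
      measurable_snd.comp (hHΦ.comp measurable_prodMk_left)
    rw [Measure.fst_map_prodMk hΦp] at h5
    rw [e1, Kernel.map_apply _ measurable_fst, h5, Measure.fst]
  · rw [← compProd_map_condDistrib hFG.aemeasurable]
    refine map_prodMk_eq_compProd _ _ hHΦ ?_
    filter_upwards [h4] with p hp using (hκ p hp).2

lemma map_prodMk_eq_of_condExp_indicator_ae_eq {Ω P S : Type*} {m mΩ : MeasurableSpace Ω}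
    [MeasurableSpace P] [MeasurableSpace S] (μ : Measure Ω) [IsProbabilityMeasure μ]
    (hm : m ≤ mΩ) {Z : Ω → P} {F G : Ω → S} (hZ : Measurable[m] Z)
    (hF : Measurable F) (hG : Measurable G)
    (h : ∀ A : Set S, MeasurableSet A →
      μ[(fun ω => A.indicator (fun _ => (1 : ℝ)) (F ω))|m]
        =ᵐ[μ] μ[(fun ω => A.indicator (fun _ => (1 : ℝ)) (G ω))|m]) :
    μ.map (fun ω => (Z ω, F ω)) = μ.map (fun ω => (Z ω, G ω)) := by
  have hZ' : Measurable Z := hZ.mono hm le_rfl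
  have key (s : Set P) (t : Set S) (hs : MeasurableSet s) (ht : MeasurableSet t) (K : Ω → S)
      (hK : Measurable K) : μ.real ((fun ω => (Z ω, K ω)) ⁻¹' s ×ˢ t)
        = ∫ ω in Z ⁻¹' s, (μ[(fun ω => t.indicator (fun _ => (1 : ℝ)) (K ω))|m]) ω ∂μ := by
    have h1 : (fun ω => t.indicator (fun _ => (1 : ℝ)) (K ω))
        = (K ⁻¹' t).indicator fun _ => (1 : ℝ) := rfl
    rw [setIntegral_condExp hm _ (hZ hs), h1, integral_indicator (hK ht), setIntegral_const,
      smul_eq_mul, mul_one, measureReal_restrict_apply (hK ht), Set.mk_preimage_prod,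
      Set.inter_comm]
    exact (integrable_const _).indicator (hK ht)
  refine Measure.ext_prod fun {s t} hs ht => ?_
  rw [Measure.map_apply (hZ'.prodMk hF) (hs.prod ht), Measure.map_apply (hZ'.prodMk hG)
    (hs.prod ht), ← measureReal_eq_measureReal_iff, key s t hs ht F hF, key s t hs ht G hG]
  exact setIntegral_congr_ae (hZ' hs) ((h t ht).mono fun ω hω _ => hω)

lemma ae_integral_condDistrib_eq_zero {Ω P X : Type*} {m mΩ : MeasurableSpace Ω}
    [mP : MeasurableSpace P] [NormedAddCommGroup X] [NormedSpace ℝ X] [CompleteSpace X]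
    [SecondCountableTopology X] [MeasurableSpace X] [BorelSpace X]
    (μ : Measure Ω) [IsProbabilityMeasure μ] (hm : m ≤ mΩ)
    {Z : Ω → P} {F : Ω → X} (hZ : Measurable[m] Z) (hF : Integrable F μ)
    (h : μ[F|m] =ᵐ[μ] 0) :
    ∀ᵐ p ∂(μ.map Z), ∫ x, x ∂(condDistrib F Z μ p) = 0 := by
  have hZ' : Measurable Z := hZ.mono hm le_rfl
  have hsm : StronglyMeasurable fun p => ∫ x, x ∂(condDistrib F Z μ p) :=
    StronglyMeasurable.integral_condDistrib
      (f := fun z : P × X => z.2) measurable_snd.stronglyMeasurable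
  refine (ae_map_iff hZ'.aemeasurable (hsm.measurable (measurableSet_singleton 0))).2 ?_
  have h1 : μ[F|mP.comap Z] =ᵐ[μ] 0 := by
    refine (condExp_condExp_of_le hZ.comap_le hm).symm.trans ?_
    refine (condExp_congr_ae h).trans ?_
    rw [condExp_zero]
  exact (condExp_ae_eq_integral_condDistrib' hZ' hF).symm.trans h1

end Coupling

section History

lemma measurable_finSnoc {A S : Type*} [MeasurableSpace A] [MeasurableSpace S] {n : ℕ}
    {u : A → Fin n → S} {v : A → S} (hu : Measurable u) (hv : Measurable v) :
    Measurable fun a => (Fin.snoc (u a) (v a) : Fin (n + 1) → S) := by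
  refine measurable_pi_iff.2 fun i => ?_
  induction i using Fin.lastCases with
  | last => simpa using hv
  | cast i => simpa using measurable_pi_iff.1 hu i

lemma measurable_finInit {S : Type*} [MeasurableSpace S] {n : ℕ} :
    Measurable fun x : Fin (n + 1) → S => (Fin.init x : Fin n → S) :=
  measurable_pi_iff.2 fun i => measurable_pi_apply i.castSucc

lemma map_init_last_lamFin (n : ℕ) :
    (lamFin (n + 1)).map (fun x => ((Fin.init x : Fin n → I), x (Fin.last n)))
      = (lamFin n).prod volume := by
  have h := (measurePreserving_piFinSuccAbove (fun _ : Fin (n + 1) => (volume : Measure I))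
    (Fin.last n)).map_eq
  rw [lamFin, lamFin, ← Measure.prod_swap, ← h, Measure.map_map measurable_swap
    (MeasurableEquiv.measurable _)]
  congr 1
  funext x
  refine Prod.ext ?_ rfl
  funext i
  simp [Fin.init, MeasurableEquiv.piFinSuccAbove]

/-- The sequence generated recursively from independent inputs, each new term being a function
of all the previous terms and of one fresh input. -/
def history {S : Type*} (H : (k : ℕ) → (Fin k → S) → I → S) : (n : ℕ) → (Fin n → I) → Fin n → S
  | 0, _ => Fin.elim0
  | n + 1, x => Fin.snoc (history H n (Fin.init x))
      (H n (history H n (Fin.init x)) (x (Fin.last n)))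

variable {S : Type*} (H : (k : ℕ) → (Fin k → S) → I → S)

lemma seqLift_eq_history (n : ℕ) (x : Fin n → I) :
    seqLift (fun k z => H k (history H k (Fin.init z)) (z (Fin.last k))) n x = history H n x := by
  induction n with
  | zero => exact Subsingleton.elim _ _
  | succ n ih =>
    funext i
    induction i using Fin.lastCases with
    | last => simp only [history, Fin.snoc_last]; rfl
    | cast i =>
      simp only [history, Fin.snoc_castSucc]
      rw [← ih]
      rfl

variable [MeasurableSpace S] {H}

lemma measurable_history (hH : ∀ k, Measurable (Function.uncurry (H k))) (n : ℕ) :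
    Measurable (history H n) := by
  induction n with
  | zero => exact measurable_of_subsingleton_codomain _
  | succ n ih =>
    have h1 := ih.comp (measurable_finInit (S := I) (n := n))
    exact measurable_finSnoc h1 ((hH n).comp (h1.prodMk (measurable_pi_apply (Fin.last n))))

lemma map_history (hH : ∀ k, Measurable (Function.uncurry (H k)))
    (law : (n : ℕ) → Measure (Fin n → S)) [∀ n, IsProbabilityMeasure (law n)]
    (hlaw : ∀ n, ((law n).prod volume).map
      (fun z : (Fin n → S) × I => (Fin.snoc z.1 (H n z.1 z.2) : Fin (n + 1) → S)) = law (n + 1))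
    (n : ℕ) : (lamFin n).map (history H n) = law n := by
  induction n with
  | zero =>
    have : IsProbabilityMeasure (lamFin 0) := by unfold lamFin; infer_instance
    have := Measure.isProbabilityMeasure_map (μ := lamFin 0) (measurable_history hH 0).aemeasurable
    ext s hs
    rcases s.eq_empty_or_nonempty with rfl | h
    · simp
    · rw [h.eq_univ, measure_univ, measure_univ]
  | succ n ih =>
    have : SFinite (lamFin n) := by unfold lamFin; infer_instance
    have hs : Measurable fun z : (Fin n → S) × I =>
        (Fin.snoc z.1 (H n z.1 z.2) : Fin (n + 1) → S) :=
      measurable_finSnoc measurable_fst (hH n)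
    have hm := measurable_history hH n
    have hi : Measurable fun x : Fin (n + 1) → I => ((Fin.init x : Fin n → I), x (Fin.last n)) :=
      measurable_finInit.prodMk (measurable_pi_apply _)
    have h2 : (law n).prod volume
        = ((lamFin n).prod volume).map (Prod.map (history H n) (id : I → I)) := by
      rw [← Measure.map_prod_map _ _ hm measurable_id, ih, Measure.map_id]
    rw [← hlaw n, h2, ← map_init_last_lamFin, Measure.map_map (hm.prodMap measurable_id) hi,
      Measure.map_map hs ((hm.prodMap measurable_id).comp hi)]
    rfl

end History

/-- for tangent sequences `(f_n)`, `(g_n)` with values in a separable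
Banach space `X`, where `(f_n)` is moreover a Bochner integrable martingale difference
sequence, the representation `(h_n, φ_n)` of Statement 5 may be chosen so that in
addition `∫_0^1 h_n(x_1,…,x_{n-1},x_n) dx_n = 0` for almost every `(x_1,…,x_{n-1})`. -/
theorem statement6 {Ω : Type*} [mΩ : MeasurableSpace Ω] (ℙ : Measure Ω)
    [IsProbabilityMeasure ℙ]
    {X : Type*} [NormedAddCommGroup X] [NormedSpace ℝ X] [CompleteSpace X]
    [TopologicalSpace.SeparableSpace X] [MeasurableSpace X] [BorelSpace X]
    (ℱ : Filtration ℕ mΩ) (hℱ0 : ℱ 0 = ⊥)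
    (f g : ℕ → Ω → X)
    (hfa : ∀ n, StronglyMeasurable[ℱ (n + 1)] (f n))
    (hga : ∀ n, StronglyMeasurable[ℱ (n + 1)] (g n))
    (hfint : ∀ n, Integrable (f n) ℙ)
    (hmds : ∀ n, ℙ[f n|ℱ n] =ᵐ[ℙ] 0)
    (htan : ∀ n : ℕ, ∀ A : Set X, MeasurableSet A →
      ℙ[(fun ω => A.indicator (fun _ => (1 : ℝ)) (f n ω))|ℱ n]
        =ᵐ[ℙ] ℙ[(fun ω => A.indicator (fun _ => (1 : ℝ)) (g n ω))|ℱ n]) :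
    ∃ (h : (k : ℕ) → (Fin (k + 1) → I) → X) (φ : (k : ℕ) → (Fin (k + 1) → I) → I),
      (∀ k, StronglyMeasurable (h k)) ∧ (∀ k, Measurable (φ k)) ∧
      (∀ k : ℕ, ∀ᵐ y ∂(lamFin k),
        MeasurePreserving (fun t : I => φ k (Fin.snoc y t)) volume volume) ∧
      (∀ n : ℕ, Measure.map (fun ω (k : Fin n) => (f k ω, g k ω)) ℙ
          = Measure.map (fun x (k : Fin n) =>
              (seqLift h n x k,
               seqLift (fun m z => h m (Fin.snoc (Fin.init z) (φ m z))) n x k))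
              (lamFin n)) ∧
      (∀ k : ℕ, ∀ᵐ y ∂(lamFin k), ∫ t : I, h k (Fin.snoc y t) = 0) := by
  have : SecondCountableTopology X := UniformSpace.secondCountable_of_separable X
  have hf (n) : Measurable (f n) := (hfa n).measurable.mono (ℱ.le _) le_rfl
  have hg (n) : Measurable (g n) := (hga n).measurable.mono (ℱ.le _) le_rfl
  let Z (n : ℕ) : Ω → Fin n → X × X := fun ω k => (f k ω, g k ω)
  have hZ (n) : Measurable[ℱ n] (Z n) :=
    @measurable_pi_iff _ _ _ (ℱ n) _ _ |>.2 fun k =>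
      ((hfa k).measurable.mono (ℱ.mono k.2) le_rfl).prodMk
        ((hga k).measurable.mono (ℱ.mono k.2) le_rfl)
  have hZ' (n) : Measurable (Z n) := (hZ n).mono (ℱ.le n) le_rfl
  choose H Φ hH hΦ hmp hcd hlaw using fun n =>
    exists_coupling_of_map_eq ℙ (hf n) (hg n)
      (map_prodMk_eq_of_condExp_indicator_ae_eq ℙ (ℱ.le n) (hZ n) (hf n) (hg n) (htan n))
  let K (n : ℕ) (p : Fin n → X × X) (t : I) : X × X := (H n p t, H n p (Φ n p t))
  have hK (n) : Measurable (Function.uncurry (K n)) :=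
    (hH n).prodMk ((hH n).comp (measurable_fst.prodMk (hΦ n)))
  have hprob (n) : IsProbabilityMeasure (ℙ.map (Z n)) :=
    Measure.isProbabilityMeasure_map (hZ' n).aemeasurable
  have hhist : ∀ n, (lamFin n).map (history K n) = ℙ.map (Z n) := by
    refine map_history hK (fun n => ℙ.map (Z n)) fun n => ?_
    have hs : Measurable fun z : (Fin n → X × X) × (X × X) =>
        (Fin.snoc z.1 z.2 : Fin (n + 1) → X × X) := measurable_finSnoc measurable_fst measurable_snd
    have hK' : Measurable fun z : (Fin n → X × X) × I =>
        (z.1, (H n z.1 z.2, H n z.1 (Φ n z.1 z.2))) := measurable_fst.prodMk (hK n)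
    have h1 := congrArg (Measure.map fun z : (Fin n → X × X) × (X × X) =>
      (Fin.snoc z.1 z.2 : Fin (n + 1) → X × X)) (hlaw n)
    rw [Measure.map_map hs hK',
      Measure.map_map hs ((hZ' n).prodMk ((hf n).prodMk (hg n)))] at h1
    refine h1.trans ?_
    congr 1
    funext ω i
    induction i using Fin.lastCases with
    | last => simp [Z]
    | cast i => simp [Z]
  have hm (n) := measurable_history hK n
  have hmi (n) : Measurable fun z : Fin (n + 1) → I =>
      (history K n (Fin.init z), z (Fin.last n)) :=
    ((hm n).comp measurable_finInit).prodMk (measurable_pi_apply _)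
  refine ⟨fun k z => H k (history K k (Fin.init z)) (z (Fin.last k)),
    fun k z => Φ k (history K k (Fin.init z)) (z (Fin.last k)),
    fun k => ((hH k).comp (hmi k)).stronglyMeasurable, fun k => (hΦ k).comp (hmi k),
    fun k => ?_, fun n => ?_, fun k => ?_⟩
  · have h1 := hmp k
    rw [← hhist k] at h1
    filter_upwards [ae_of_ae_map (hm k).aemeasurable h1] with y hy
    simpa using hy
  · rw [← hhist n]
    congr 1
    funext x
    rw [← seqLift_eq_history]
    funext k
    simp [seqLift, K]
  · have h1 := hcd k
    have h2 := ae_integral_condDistrib_eq_zero ℙ (ℱ.le k) (hZ k) (hfint k) (hmds k)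
    rw [← hhist k] at h1 h2
    filter_upwards [ae_of_ae_map (hm k).aemeasurable h1, ae_of_ae_map (hm k).aemeasurable h2]
      with y hy1 hy2
    have hHy : Measurable (H k (history K k y)) := (hH k).comp measurable_prodMk_left
    rw [← hy1, integral_map hHy.aemeasurable (f := fun x : X => x)
      measurable_id.aestronglyMeasurable] at hy2
    simpa using hy2
end
end

section
/- Let X be a Banach space and let h_n : [0,1]^n → X be Bochner integrable functions with ∫_0^1 h_n(x_1,…,x_{n−1},x_n) dx_n = 0 for almost every (x_1,…,x_{n−1}). On [0,1]^ℕ × [0,1]^ℕ (each factor with product Lebesgue measure), define d_n((x_m),(y_m)) = h_n(x_1,…,x_{n−1},x_n) and e_n((x_m),(y_m)) = h_n(x_1,…,x_{n−1},y_n), and set r_{2n−1} = d_n + e_n and r_{2n} = d_n − e_n. Then (r_k)_{k≥1} is a martingale difference sequence with respect to the filtration (𝒢_k), where 𝒢_{2n} = ℒ_n ⊗ ℒ_n and 𝒢_{2n−1} is the sub-sigma-field of 𝒢_{2n} generated by sets of the form {((x_m),(y_m)) : (x_1,…,x_n) ∈ A × C, (y_1,…,y_n) ∈ B × C} with A, B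 ∈ ℒ_{n−1} and C ∈ ℒ_1; moreover Σ_{n=1}^N d_n = (1/2) Σ_{k=1}^{2N} r_k and Σ_{n=1}^N e_n = (1/2) Σ_{k=1}^{2N} (−1)^{k+1} r_k. -/
open MeasureTheory MeasurableSpace
open scoped unitInterval

noncomputable section

/-- `ℒ_n`: the sigma field on `[0,1]^ℕ` generated by the first `n` coordinates. -/
def Ln (n : ℕ) : MeasurableSpace (ℕ → I) :=
  MeasurableSpace.comap (fun x (i : Fin n) => x i) MeasurableSpace.pi

/-- The filtration `(𝒢_k)` (1-based indexing in `k`, with `𝒢_0` trivial):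
`𝒢_{2n} = ℒ_n ⊗ ℒ_n`, and `𝒢_{2n-1}` is generated by the sets
`{((x_m),(y_m)) : (x_1,…,x_n) ∈ A × C, (y_1,…,y_n) ∈ B × C}` with
`A, B ∈ ℒ_{n-1}` and `C ∈ ℒ_1`. -/
def GG (k : ℕ) : MeasurableSpace ((ℕ → I) × (ℕ → I)) :=
  if k % 2 = 0 then
    (Ln (k / 2)).comap Prod.fst ⊔ (Ln (k / 2)).comap Prod.snd
  else
    MeasurableSpace.generateFrom
      {s | ∃ (A B : Set (Fin (k / 2) → I)) (C : Set I),
        MeasurableSet A ∧ MeasurableSet B ∧ MeasurableSet C ∧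
        s = {p : (ℕ → I) × (ℕ → I) |
              (fun i : Fin (k / 2) => p.1 i) ∈ A ∧ p.1 (k / 2) ∈ C ∧
              (fun i : Fin (k / 2) => p.2 i) ∈ B ∧ p.2 (k / 2) ∈ C}}

/-- The first `n` coordinates of both components, followed by the `n`-th coordinates of both
components. -/
def splitCoords (n : ℕ) (p : (ℕ → I) × (ℕ → I)) :
    ((Fin n → I) × (Fin n → I)) × (I × I) :=
  ((fun i => p.1 i, fun i => p.2 i), (p.1 n, p.2 n))

instance isProbabilityMeasure_lamFin (n : ℕ) : IsProbabilityMeasure (lamFin n) := by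
  unfold lamFin; infer_instance

lemma GG_even (n : ℕ) :
    GG (2 * n) = (Ln n).comap Prod.fst ⊔ (Ln n).comap Prod.snd := by
  simp [GG]

lemma GG_odd (n : ℕ) :
    GG (2 * n + 1) = MeasurableSpace.generateFrom
      {s | ∃ (A B : Set (Fin n → I)) (C : Set I),
        MeasurableSet A ∧ MeasurableSet B ∧ MeasurableSet C ∧
        s = {p : (ℕ → I) × (ℕ → I) |
              (fun i : Fin n => p.1 i) ∈ A ∧ p.1 n ∈ C ∧
              (fun i : Fin n => p.2 i) ∈ B ∧ p.2 n ∈ C}} := by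
  have h2 : (2 * n + 1) / 2 = n := by omega
  unfold GG
  rw [if_neg (by omega), h2]

lemma GG_even_eq_comap (n : ℕ) :
    GG (2 * n) = MeasurableSpace.comap (fun p => (splitCoords n p).1) inferInstance := by
  rw [GG_even, Ln]
  change _ = MeasurableSpace.comap _ (MeasurableSpace.comap _ _ ⊔ MeasurableSpace.comap _ _)
  simp only [MeasurableSpace.comap_sup, MeasurableSpace.comap_comp]
  rfl

lemma GG_even_le {n : ℕ} {M : MeasurableSpace ((ℕ → I) × (ℕ → I))}
    (h1 : Measurable[M] fun p (i : Fin n) => p.1 i)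
    (h2 : Measurable[M] fun p (i : Fin n) => p.2 i) : GG (2 * n) ≤ M := by
  rw [GG_even_eq_comap]
  exact (h1.prodMk h2).comap_le

lemma measurable_GG_even_fst (n : ℕ) :
    Measurable[GG (2 * n)] fun p (i : Fin n) => p.1 i := by
  rw [GG_even_eq_comap]
  exact measurable_fst.comp (comap_measurable _)

lemma measurable_GG_even_snd (n : ℕ) :
    Measurable[GG (2 * n)] fun p (i : Fin n) => p.2 i := by
  rw [GG_even_eq_comap]
  exact measurable_snd.comp (comap_measurable _)

lemma measurableSet_GG_odd {n : ℕ} {A B : Set (Fin n → I)} {C : Set I}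
    (hA : MeasurableSet A) (hB : MeasurableSet B) (hC : MeasurableSet C) :
    MeasurableSet[GG (2 * n + 1)] {p : (ℕ → I) × (ℕ → I) |
      (fun i : Fin n => p.1 i) ∈ A ∧ p.1 n ∈ C ∧ (fun i : Fin n => p.2 i) ∈ B ∧ p.2 n ∈ C} := by
  rw [GG_odd]
  exact MeasurableSpace.measurableSet_generateFrom ⟨A, B, C, hA, hB, hC, rfl⟩

lemma measurable_GG_odd_fst (n : ℕ) :
    Measurable[GG (2 * n + 1)] fun p (i : Fin n) => p.1 i := fun A hA => by
  convert measurableSet_GG_odd hA MeasurableSet.univ MeasurableSet.univ using 1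
  ext p
  simp

lemma measurable_GG_odd_snd (n : ℕ) :
    Measurable[GG (2 * n + 1)] fun p (i : Fin n) => p.2 i := fun B hB => by
  convert measurableSet_GG_odd MeasurableSet.univ hB MeasurableSet.univ using 1
  ext p
  simp

lemma measurable_GG_odd_max (n : ℕ) :
    Measurable[GG (2 * n + 1)] fun p => max (p.1 n) (p.2 n) := by
  refine @measurable_of_Iic _ _ _ _ _ (GG (2 * n + 1)) _ _ _ _ fun a => ?_
  convert measurableSet_GG_odd (n := n) MeasurableSet.univ MeasurableSet.univ
    (measurableSet_Iic (a := a)) using 1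
  ext p
  simp

lemma measurable_GG_odd_min (n : ℕ) :
    Measurable[GG (2 * n + 1)] fun p => min (p.1 n) (p.2 n) := by
  refine @measurable_of_Ici _ _ _ _ _ (GG (2 * n + 1)) _ _ _ _ fun a => ?_
  convert measurableSet_GG_odd (n := n) MeasurableSet.univ MeasurableSet.univ
    (measurableSet_Ici (a := a)) using 1
  ext p
  simp

lemma Measurable.comp_castSucc {α β : Type*} {_ : MeasurableSpace α} [MeasurableSpace β] {n : ℕ}
    {f : α → Fin (n + 1) → β} (hf : Measurable f) :
    Measurable fun a (i : Fin n) => f a i.castSucc :=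
  measurable_pi_iff.2 fun i => (measurable_pi_apply i.castSucc).comp hf

lemma measurable_snoc {α β : Type*} {_ : MeasurableSpace α} [MeasurableSpace β] {n : ℕ}
    {f : α → Fin n → β} {g : α → β} (hf : Measurable f) (hg : Measurable g) :
    Measurable fun a => (Fin.snoc (f a) (g a) : Fin (n + 1) → β) := by
  refine measurable_pi_iff.2 fun i => ?_
  induction i using Fin.lastCases with
  | last => simpa using hg
  | cast i => simpa using! (measurable_pi_apply i).comp hf

lemma GG_odd_le_even (n : ℕ) : GG (2 * n + 1) ≤ GG (2 * (n + 1)) := by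
  have h1 := (measurable_pi_apply (Fin.last n)).comp (measurable_GG_even_fst (n + 1))
  have h2 := (measurable_pi_apply (Fin.last n)).comp (measurable_GG_even_snd (n + 1))
  conv_lhs => rw [GG_odd]
  refine MeasurableSpace.generateFrom_le ?_
  rintro _ ⟨A, B, C, hA, hB, hC, rfl⟩
  have hA' := (measurable_GG_even_fst (n + 1)).comp_castSucc hA
  have hB' := (measurable_GG_even_snd (n + 1)).comp_castSucc hB
  exact hA'.inter ((h1 hC).inter (hB'.inter (h2 hC)))

lemma monotone_GG : Monotone GG := by
  refine monotone_nat_of_le_succ fun k => ?_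
  obtain ⟨n, rfl | rfl⟩ := k.even_or_odd'
  · exact GG_even_le (measurable_GG_odd_fst n) (measurable_GG_odd_snd n)
  · exact GG_odd_le_even n

lemma GG_le (k : ℕ) : GG k ≤ (inferInstance : MeasurableSpace ((ℕ → I) × (ℕ → I))) :=
  (monotone_GG (by omega : k ≤ 2 * k)).trans <| GG_even_le
    (by fun_prop) (by fun_prop)

lemma MeasureTheory.MeasurePreserving.setIntegral_preimage {α β E : Type*} [MeasurableSpace α]
    [MeasurableSpace β] [NormedAddCommGroup E] [NormedSpace ℝ E] {μ : Measure α} {ν : Measure β}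
    {φ : α → β} (hφ : MeasurePreserving φ μ ν) {S : Set β} (hS : MeasurableSet S) {g : β → E}
    (hg : AEStronglyMeasurable g ν) : ∫ a in φ ⁻¹' S, g (φ a) ∂μ = ∫ b in S, g b ∂ν := by
  rw [← hφ.map_eq] at hg ⊢
  exact (setIntegral_map hS hg hφ.aemeasurable).symm

lemma MeasureTheory.measurePreserving_prodProdProdComm {α β γ δ : Type*} [MeasurableSpace α]
    [MeasurableSpace β] [MeasurableSpace γ] [MeasurableSpace δ] (μa : Measure α) (μb : Measure β)
    (μc : Measure γ) (μd : Measure δ) [SFinite μa] [SFinite μb] [SFinite μc] [SFinite μd] :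
    MeasurePreserving (fun p : (α × β) × (γ × δ) => ((p.1.1, p.2.1), (p.1.2, p.2.2)))
      ((μa.prod μb).prod (μc.prod μd)) ((μa.prod μc).prod (μb.prod μd)) := by
  have swapMiddle : MeasurePreserving (fun p : β × (γ × δ) => (p.2.1, (p.1, p.2.2)))
      (μb.prod (μc.prod μd)) (μc.prod (μb.prod μd)) :=
    (measurePreserving_prodAssoc μc μb μd).comp
      ((Measure.measurePreserving_swap.prod (.id μd)).comp
        ((measurePreserving_prodAssoc μb μc μd).symm MeasurableEquiv.prodAssoc))
  exact ((measurePreserving_prodAssoc μa μc _).symm MeasurableEquiv.prodAssoc).comp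
    (((MeasurePreserving.id μa).prod swapMiddle).comp (measurePreserving_prodAssoc μa μb _))

section Law

variable {μ : Measure (ℕ → I)}

lemma measurePreserving_restrict
    (hμ : ∀ (n : ℕ) (A : Fin n → Set I), (∀ i, MeasurableSet (A i)) →
      μ {x : ℕ → I | ∀ i : Fin n, x i ∈ A i} = ∏ i : Fin n, volume (A i)) (n : ℕ) :
    MeasurePreserving (fun (x : ℕ → I) (i : Fin n) => x i) μ (lamFin n) := by
  have hm : Measurable (fun (x : ℕ → I) (i : Fin n) => x i) := by fun_prop
  refine ⟨hm, (Measure.pi_eq fun A hA => ?_).symm⟩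
  rw [Measure.map_apply hm (MeasurableSet.univ_pi hA), ← hμ n A hA]
  congr 1
  ext x
  simp

lemma measurePreserving_snoc (n : ℕ) :
    MeasurePreserving (fun q : (Fin n → I) × I => (Fin.snoc q.1 q.2 : Fin (n + 1) → I))
      ((lamFin n).prod volume) (lamFin (n + 1)) := by
  have := ((measurePreserving_piFinSuccAbove (fun _ : Fin (n + 1) => (volume : Measure I))
    (Fin.last n)).symm _).comp
      (Measure.measurePreserving_swap (μ := lamFin n) (ν := (volume : Measure I)))
  convert this using 1
  · ext q : 1
    exact (Fin.insertNth_last' q.2 q.1).symm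
  · rfl

lemma measurePreserving_init_last
    (hμ : ∀ (n : ℕ) (A : Fin n → Set I), (∀ i, MeasurableSet (A i)) →
      μ {x : ℕ → I | ∀ i : Fin n, x i ∈ A i} = ∏ i : Fin n, volume (A i)) (n : ℕ) :
    MeasurePreserving (fun x : ℕ → I => ((fun i : Fin n => x i), x n)) μ
      ((lamFin n).prod volume) := by
  have := (Measure.measurePreserving_swap.comp
    (measurePreserving_piFinSuccAbove (fun _ : Fin (n + 1) => (volume : Measure I))
      (Fin.last n))).comp (measurePreserving_restrict hμ (n + 1))
  convert this using 1
  · ext x i <;> simp [MeasurableEquiv.piFinSuccAbove, Fin.init]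
  · rfl

lemma measurePreserving_splitCoords [IsProbabilityMeasure μ]
    (hμ : ∀ (n : ℕ) (A : Fin n → Set I), (∀ i, MeasurableSet (A i)) →
      μ {x : ℕ → I | ∀ i : Fin n, x i ∈ A i} = ∏ i : Fin n, volume (A i)) (n : ℕ) :
    MeasurePreserving (splitCoords n) (μ.prod μ)
      (((lamFin n).prod (lamFin n)).prod (volume.prod volume)) :=
  (measurePreserving_prodProdProdComm _ _ _ _).comp
    ((measurePreserving_init_last hμ n).prod (measurePreserving_init_last hμ n))

end Law

/-- Sets of `𝒢_{2n+1}` are invariant under exchanging the `n`-th coordinates. -/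
lemma GG_odd_le_comap_invariants (n : ℕ) :
    GG (2 * n + 1) ≤ (MeasurableSpace.invariants
      (Prod.map id Prod.swap : ((Fin n → I) × (Fin n → I)) × (I × I) → _)).comap
        (splitCoords n) := by
  rw [GG_odd]
  refine MeasurableSpace.generateFrom_le ?_
  rintro _ ⟨A, B, C, hA, hB, hC, rfl⟩
  refine ⟨(A ×ˢ B) ×ˢ (C ×ˢ C), MeasurableSpace.measurableSet_invariants.2
    ⟨(hA.prod hB).prod (hC.prod hC), ?_⟩, ?_⟩
  · ext q
    simp
    tauto
  · ext p
    simp [splitCoords]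
    tauto

section MartingaleDifference

variable {X : Type*} [NormedAddCommGroup X]

/-- The summand `d_n` as a function of the split coordinates. -/
def headTerm {n : ℕ} (f : (Fin (n + 1) → I) → X)
    (q : ((Fin n → I) × (Fin n → I)) × (I × I)) : X := f (Fin.snoc q.1.1 q.2.1)

lemma snoc_restrict {n : ℕ} (x : ℕ → I) :
    (Fin.snoc (fun i : Fin n => x i) (x n) : Fin (n + 1) → I) = fun j : Fin (n + 1) => x j := by
  ext j
  induction j using Fin.lastCases <;> simp

variable {n : ℕ} {f : (Fin (n + 1) → I) → X}

lemma integrable_headTerm (hf : Integrable f (lamFin (n + 1))) :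
    Integrable (headTerm f) (((lamFin n).prod (lamFin n)).prod (volume.prod volume)) :=
  ((measurePreserving_snoc n).comp
    (measurePreserving_fst.prod measurePreserving_fst)).integrable_comp_of_integrable hf

lemma measurePreserving_swap_last (n : ℕ) :
    MeasurePreserving (Prod.map id Prod.swap : ((Fin n → I) × (Fin n → I)) × (I × I) → _)
      (((lamFin n).prod (lamFin n)).prod (volume.prod volume))
      (((lamFin n).prod (lamFin n)).prod (volume.prod volume)) :=
  (MeasurePreserving.id _).prod Measure.measurePreserving_swap

lemma integrable_headTerm_swap (hf : Integrable f (lamFin (n + 1))) :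
    Integrable (headTerm f ∘ Prod.map id Prod.swap)
      (((lamFin n).prod (lamFin n)).prod (volume.prod volume)) :=
  (measurePreserving_swap_last n).integrable_comp_of_integrable (integrable_headTerm hf)

variable [NormedSpace ℝ X]

/-- The exchange of the last coordinates as a measurable equivalence. -/
def swapLastEquiv (n : ℕ) : ((Fin n → I) × (Fin n → I)) × (I × I) ≃ᵐ
    ((Fin n → I) × (Fin n → I)) × (I × I) :=
  (MeasurableEquiv.refl _).prodCongr MeasurableEquiv.prodComm

lemma setIntegral_comp_swap_last (g : ((Fin n → I) × (Fin n → I)) × (I × I) → X)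
    {S : Set (((Fin n → I) × (Fin n → I)) × (I × I))}
    (hS : Prod.map id Prod.swap ⁻¹' S = S) :
    ∫ q in S, g (Prod.map id Prod.swap q)
      ∂((lamFin n).prod (lamFin n)).prod (volume.prod volume) =
    ∫ q in S, g q ∂((lamFin n).prod (lamFin n)).prod (volume.prod volume) := by
  have := (measurePreserving_swap_last n).setIntegral_preimage_emb
    (swapLastEquiv n).measurableEmbedding g S
  rwa [hS] at this

lemma setIntegral_headTerm_eq_zero (hf : Integrable f (lamFin (n + 1)))
    (hzero : ∀ᵐ y ∂(lamFin n), ∫ t : I, f (Fin.snoc y t) = 0)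
    {S : Set ((Fin n → I) × (Fin n → I))} :
    ∫ q in S ×ˢ Set.univ, headTerm f q
      ∂((lamFin n).prod (lamFin n)).prod (volume.prod volume) = 0 := by
  rw [setIntegral_prod _ (integrable_headTerm hf).integrableOn]
  refine integral_eq_zero_of_ae (ae_restrict_of_ae ?_)
  filter_upwards [measurePreserving_fst.quasiMeasurePreserving.ae hzero] with u hu
  have := integral_fun_fst (μ := (volume : Measure I)) (ν := (volume : Measure I))
    fun t => f (Fin.snoc u.1 t)
  simpa [headTerm, hu] using this

variable [CompleteSpace X]

lemma condExp_eq_zero_of_setIntegral {Ω : Type*} {m m₀ : MeasurableSpace Ω} {μ : Measure Ω}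
    [IsFiniteMeasure μ] (hm : m ≤ m₀) {g : Ω → X} (hg : Integrable g μ)
    (h0 : ∀ s, MeasurableSet[m] s → ∫ x in s, g x ∂μ = 0) : μ[g|m] =ᵐ[μ] 0 :=
  (ae_eq_condExp_of_forall_setIntegral_eq hm hg (fun _ _ _ => integrableOn_zero)
    (fun s hs _ => by simp [h0 s hs]) aestronglyMeasurable_zero).symm

end MartingaleDifference

/-- let `μ` be the product Lebesgue measure on `[0,1]^ℕ`
(characterized by its values on cylinder sets), let `h_n : [0,1]^n → X` be Bochner
integrable with `∫_0^1 h_n(x_1,…,x_{n-1},x_n) dx_n = 0` for a.e. `(x_1,…,x_{n-1})`, and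
on `[0,1]^ℕ × [0,1]^ℕ` set `d_n((x_m),(y_m)) = h_n(x_1,…,x_n)`,
`e_n((x_m),(y_m)) = h_n(x_1,…,x_{n-1},y_n)`, `r_{2n-1} = d_n + e_n`,
`r_{2n} = d_n - e_n`.  Then `(r_k)` is a martingale difference sequence with respect to
the filtration `(𝒢_k)` of `GG`, and `Σ_{n≤N} d_n = ½ Σ_{k≤2N} r_k`,
`Σ_{n≤N} e_n = ½ Σ_{k≤2N} (-1)^{k+1} r_k`.
(The sequences `d, e, r` below are 0-based: `d n = d_{n+1}`, `r j = r_{j+1}`.) -/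
theorem statement16 {X : Type*} [NormedAddCommGroup X] [NormedSpace ℝ X]
    [CompleteSpace X] [MeasurableSpace X] [BorelSpace X]
    (μ : Measure (ℕ → I)) [IsProbabilityMeasure μ]
    (hμ : ∀ (n : ℕ) (A : Fin n → Set I), (∀ i, MeasurableSet (A i)) →
      μ {x : ℕ → I | ∀ i : Fin n, x i ∈ A i} = ∏ i : Fin n, volume (A i))
    (h : (k : ℕ) → (Fin (k + 1) → I) → X)
    (hmeas : ∀ k, StronglyMeasurable (h k))
    (hint : ∀ k, Integrable (h k) (lamFin (k + 1)))
    (hzero : ∀ k : ℕ, ∀ᵐ y ∂(lamFin k), ∫ t : I, h k (Fin.snoc y t) = 0)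
    (d e r : ℕ → (ℕ → I) × (ℕ → I) → X)
    (hd : ∀ n p, d n p = h n (fun j : Fin (n + 1) => p.1 j))
    (he : ∀ n p, e n p = h n (Fin.snoc (fun j : Fin n => p.1 j) (p.2 n)))
    (hr : ∀ j p, r j p = if j % 2 = 0 then d (j / 2) p + e (j / 2) p
                         else d (j / 2) p - e (j / 2) p) :
    -- `(𝒢_k)` is a filtration (contained in the ambient sigma field)
    Monotone GG ∧
    (∀ k, GG k ≤ (inferInstance : MeasurableSpace ((ℕ → I) × (ℕ → I)))) ∧
    -- `(r_k)` is a martingale difference sequence with respect to `(𝒢_k)`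
    (∀ j, StronglyMeasurable[GG (j + 1)] (r j)) ∧
    (∀ j, Integrable (r j) (μ.prod μ)) ∧
    (∀ j, (μ.prod μ)[r j|GG j] =ᵐ[μ.prod μ] 0) ∧
    -- the summation identities
    (∀ (N : ℕ) (p : (ℕ → I) × (ℕ → I)),
      ∑ n ∈ Finset.range N, d n p
        = (2 : ℝ)⁻¹ • ∑ k ∈ Finset.range (2 * N), r k p) ∧
    (∀ (N : ℕ) (p : (ℕ → I) × (ℕ → I)),
      ∑ n ∈ Finset.range N, e n p
        = (2 : ℝ)⁻¹ • ∑ k ∈ Finset.range (2 * N), ((-1 : ℝ) ^ k) • r k p) := by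
  have hd' (n : ℕ) : d n = headTerm (h n) ∘ splitCoords n := by
    ext p
    simp [hd, headTerm, splitCoords, snoc_restrict]
  have he' (n : ℕ) : e n = (headTerm (h n) ∘ Prod.map id Prod.swap) ∘ splitCoords n := by
    ext p
    simp [he, headTerm, splitCoords]
  have r_even (n : ℕ) : r (2 * n) = d n + e n := by
    ext p
    simp [hr]
  have r_odd (n : ℕ) : r (2 * n + 1) = d n - e n := by
    ext p
    have h2 : (2 * n + 1) / 2 = n := by omega
    rw [hr, if_neg (by omega), h2]
    rfl
  have hΦ := measurePreserving_splitCoords hμ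
  have hdi (n : ℕ) : Integrable (d n) (μ.prod μ) := by
    rw [hd']
    exact (hΦ n).integrable_comp_of_integrable (integrable_headTerm (hint n))
  have hei (n : ℕ) : Integrable (e n) (μ.prod μ) := by
    rw [he']
    exact (hΦ n).integrable_comp_of_integrable (integrable_headTerm_swap (hint n))
  have hri (j : ℕ) : Integrable (r j) (μ.prod μ) := by
    obtain ⟨n, rfl | rfl⟩ := j.even_or_odd'
    · rw [r_even]; exact (hdi n).add (hei n)
    · rw [r_odd]; exact (hdi n).sub (hei n)
  have hsum (N : ℕ) (p : (ℕ → I) × (ℕ → I)) (c : ℕ → ℝ) :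
      ∑ k ∈ Finset.range (2 * N), c k • r k p =
        ∑ n ∈ Finset.range N, (c (2 * n) • (d n p + e n p) + c (2 * n + 1) • (d n p - e n p)) := by
    induction N with
    | zero => simp
    | succ N ih =>
      rw [show 2 * (N + 1) = 2 * N + 1 + 1 by ring, Finset.sum_range_succ, Finset.sum_range_succ,
        ih, Finset.sum_range_succ, r_even, r_odd, add_assoc]
      rfl
  refine ⟨monotone_GG, GG_le, fun j => ?_, hri, fun j => ?_, fun N p => ?_, fun N p => ?_⟩
  · obtain ⟨n, rfl | rfl⟩ := j.even_or_odd'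
    · have hsymm : r (2 * n) = fun p =>
          h n (Fin.snoc (fun i : Fin n => p.1 i) (max (p.1 n) (p.2 n))) +
          h n (Fin.snoc (fun i : Fin n => p.1 i) (min (p.1 n) (p.2 n))) := by
        ext p
        rw [r_even, Pi.add_apply, hd, he, ← snoc_restrict]
        rcases le_total (p.1 n) (p.2 n) with hle | hle
        · simp [hle, add_comm]
        · simp [hle]
      rw [hsymm]
      exact ((hmeas n).comp_measurable
          (measurable_snoc (measurable_GG_odd_fst n) (measurable_GG_odd_max n))).add
        ((hmeas n).comp_measurable
          (measurable_snoc (measurable_GG_odd_fst n) (measurable_GG_odd_min n)))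
    · have hdm : StronglyMeasurable[GG (2 * (n + 1))] (d n) := by
        rw [funext (hd n)]
        exact (hmeas n).comp_measurable (measurable_GG_even_fst (n + 1))
      have hem : StronglyMeasurable[GG (2 * (n + 1))] (e n) := by
        rw [funext (he n)]
        exact (hmeas n).comp_measurable (measurable_snoc
          (measurable_GG_even_fst (n + 1)).comp_castSucc
          ((measurable_pi_apply (Fin.last n)).comp (measurable_GG_even_snd (n + 1))))
      rw [r_odd]
      exact hdm.sub hem
  · refine condExp_eq_zero_of_setIntegral (GG_le j) (hri j) fun s hs => ?_
    obtain ⟨n, rfl | rfl⟩ := j.even_or_odd'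
    · rw [GG_even_eq_comap] at hs
      obtain ⟨S, hS, rfl⟩ := hs
      have hpre : (fun p => (splitCoords n p).1) ⁻¹' S = splitCoords n ⁻¹' (S ×ˢ Set.univ) := by
        ext p
        simp
      have hdz := setIntegral_headTerm_eq_zero (hint n) (hzero n) (S := S)
      have hez := setIntegral_comp_swap_last (headTerm (h n)) (S := S ×ˢ Set.univ)
        (by ext q; simp)
      rw [hdz] at hez
      rw [r_even, hpre]
      simp only [Pi.add_apply]
      rw [integral_add (hdi n).integrableOn (hei n).integrableOn, hd', he']
      simp only [Function.comp_apply]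
      rw [(hΦ n).setIntegral_preimage (hS.prod MeasurableSet.univ)
          (integrable_headTerm (hint n)).aestronglyMeasurable, hdz, zero_add, ← hez]
      exact (hΦ n).setIntegral_preimage (hS.prod MeasurableSet.univ)
        (integrable_headTerm_swap (hint n)).aestronglyMeasurable
    · obtain ⟨S, hS, rfl⟩ := GG_odd_le_comap_invariants n s hs
      obtain ⟨hSm, hSinv⟩ := MeasurableSpace.measurableSet_invariants.1 hS
      rw [r_odd]
      simp only [Pi.sub_apply]
      rw [integral_sub (hdi n).integrableOn (hei n).integrableOn, hd', he', sub_eq_zero]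
      simp only [Function.comp_apply]
      rw [(hΦ n).setIntegral_preimage hSm
          (integrable_headTerm (hint n)).aestronglyMeasurable,
        ← setIntegral_comp_swap_last _ hSinv]
      exact ((hΦ n).setIntegral_preimage hSm
        (integrable_headTerm_swap (hint n)).aestronglyMeasurable).symm
  · have := hsum N p fun _ => 1
    simp only [one_smul] at this
    rw [this, Finset.smul_sum]
    refine Finset.sum_congr rfl fun n _ => ?_
    module
  · rw [hsum N p fun k => (-1) ^ k, Finset.smul_sum]
    refine Finset.sum_congr rfl fun n _ => ?_
    simp only [pow_succ, pow_mul]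
    module
end
end
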